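/- There is an absolute constant C > 0 with the following property. For every finite rooted binary tree T, every leaf assignment χ of T, and every maximum path decomposition P_max(T) of T with respect to χ, the sum over all vertices v of T of log(1 + |H_v|) is at most C times the sum over all paths p ∈ P_max(T) of |p|·log(1 + |p|). -/

import Mathlib

open scoped Classical
noncomputable section

/-- A finite rooted binary tree on vertex set `V`: every non-root vertex has a parent,
the root has none, depths are consistent (ensuring acyclicity), and each vertex has
at most two children. -/
structure RBTree (V : Type) [Fintype V] [DecidableEq V] where
  parent : V → Option V
  root : V
  depth : V → ℕ
  parent_root : parent root = none
  root_of_parent_none : ∀ v, parent v = none → v = root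
  depth_parent : ∀ v u, parent v = some u → depth v = depth u + 1
  binary : ∀ v : V, (Finset.univ.filter (fun c => parent c = some v)).card ≤ 2

namespace RBTree

variable {V : Type} [Fintype V] [DecidableEq V]

/-- The children of a vertex. -/
def children (T : RBTree V) (v : V) : Finset V :=
  Finset.univ.filter (fun c => T.parent c = some v)

/-- A leaf is a vertex with no children. -/
def IsLeaf (T : RBTree V) (v : V) : Prop := T.children v = ∅

/-- Iterated parent map. -/
def parentIter (T : RBTree V) : ℕ → V → Option V
  | 0, v => some v
  | n + 1, v => (T.parentIter n v).bind T.parent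

/-- `u` is a (weak) ancestor of `v`: `u` lies on the path from `v` to the root
(including `v` itself). -/
def Anc (T : RBTree V) (u v : V) : Prop := ∃ n, T.parentIter n v = some u

/-- `u` is a strict ancestor of `v`. -/
def StrictAnc (T : RBTree V) (u v : V) : Prop := ∃ n, 0 < n ∧ T.parentIter n v = some u

/-- `L(T_v)`: the leaves of the subtree rooted at `v`. -/
def subtreeLeaves (T : RBTree V) (v : V) : Finset V :=
  Finset.univ.filter (fun l => T.IsLeaf l ∧ T.Anc v l)

/-- A leaf assignment `χ` assigns to each internal vertex a set of leaves containing
exactly one leaf from the subtree of each of its children (and nothing else);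
leaves are assigned the empty set. -/
structure LeafAssignment (T : RBTree V) where
  χ : V → Finset V
  mem_leaf : ∀ v l, l ∈ χ v → T.IsLeaf l
  mem_desc : ∀ v l, l ∈ χ v → ∃ c ∈ T.children v, T.Anc c l
  unique_child : ∀ v, ∀ c ∈ T.children v, ∃! l, l ∈ χ v ∧ T.Anc c l

/-- The heap `H_v = {u ∈ A(v) : χ(u) ∩ L(T_v) ≠ ∅}` of a vertex `v`. -/
def heap (T : RBTree V) (A : T.LeafAssignment) (v : V) : Finset V :=
  Finset.univ.filter (fun u => T.StrictAnc u v ∧ (A.χ u ∩ T.subtreeLeaves v).Nonempty)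

/-- A leaf path: the set of vertices on a monotone path from some leaf `ℓ` up to an
ancestor `b` of `ℓ`. -/
def IsLeafPath (T : RBTree V) (p : Finset V) : Prop :=
  ∃ ℓ b, T.IsLeaf ℓ ∧ T.Anc b ℓ ∧
    p = Finset.univ.filter (fun u => T.Anc u ℓ ∧ T.Anc b u)

/-- The base `b(p)` of a path: its vertex closest to the root. -/
def base (T : RBTree V) (p : Finset V) : V :=
  if h : ∃ b, b ∈ p ∧ ∀ w ∈ p, T.Anc b w then h.choose else T.root

/-- The leaf `ℓ(p)` of a path. -/
def pathLeaf (T : RBTree V) (p : Finset V) : V :=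
  if h : ∃ l, l ∈ p ∧ ∀ w ∈ p, T.Anc w l then h.choose else T.root

/-- `H_p = H_{b(p)}`. -/
def pathHeap (T : RBTree V) (A : T.LeafAssignment) (p : Finset V) : Finset V :=
  T.heap A (T.base p)

/-- A path decomposition: a partition of the vertex set into leaf paths. -/
def IsPathDecomp (T : RBTree V) (P : Finset (Finset V)) : Prop :=
  (∀ p ∈ P, T.IsLeafPath p) ∧ (∀ v : V, ∃! p, p ∈ P ∧ v ∈ p)

/-- `q` is a child of `p` in the shrub: the parent of `b(q)` lies on `p`. -/
def ShrubParent (T : RBTree V) (p q : Finset V) : Prop :=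
  ∃ u, T.parent (T.base q) = some u ∧ u ∈ p

/-- `p` is a strict ancestor of `q` in the shrub: some vertex of `p` is a strict
ancestor of `b(q)` in `T` (and `p ≠ q`). -/
def ShrubStrictAnc (T : RBTree V) (p q : Finset V) : Prop :=
  p ≠ q ∧ ∃ u ∈ p, T.StrictAnc u (T.base q)

/-- Weak ancestor relation in the shrub. -/
def ShrubAnc (T : RBTree V) (p q : Finset V) : Prop :=
  p = q ∨ T.ShrubStrictAnc p q

/-- A maximum path decomposition w.r.t. a leaf assignment: a path decomposition in
which each internal vertex lies on the same path as a child of maximal heap size. -/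
def IsMaxPathDecomp (T : RBTree V) (A : T.LeafAssignment) (P : Finset (Finset V)) : Prop :=
  T.IsPathDecomp P ∧
    ∀ p ∈ P, ∀ v ∈ p, ∀ c ∈ T.children v, c ∈ p →
      ∀ c' ∈ T.children v, (T.heap A c').card ≤ (T.heap A c).card

/-- A path `p` is short if `|p| < sqrt(|H_p|)/100`. -/
def IsShort (T : RBTree V) (A : T.LeafAssignment) (p : Finset V) : Prop :=
  (p.card : ℝ) < Real.sqrt ((T.pathHeap A p).card) / 100

/-- The tall support chain of a path `p`: the maximal chain of tall paths in the shrub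
starting at the parent of `p` and going up. -/
def TallChain (T : RBTree V) (A : T.LeafAssignment) (P : Finset (Finset V)) (p : Finset V) :
    Finset (Finset V) :=
  P.filter (fun q => T.ShrubStrictAnc q p ∧
    ∀ r ∈ P, T.ShrubStrictAnc r p → T.ShrubAnc q r → ¬ T.IsShort A r)

/-- A short path is supported if at least `|H_p|/100` of the vertices of `H_p` lie on
paths of its tall support chain. -/
def IsSupported (T : RBTree V) (A : T.LeafAssignment) (P : Finset (Finset V))
    (p : Finset V) : Prop :=
  ((T.pathHeap A p).card : ℝ) / 100 ≤
    (((T.pathHeap A p).filter (fun v => ∃ q ∈ T.TallChain A P p, v ∈ q)).card : ℝ)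

/-- The reduced heap `H̃_p`: vertices of `H_p` not lying on the tall support chain. -/
def redHeap (T : RBTree V) (A : T.LeafAssignment) (P : Finset (Finset V))
    (p : Finset V) : Finset V :=
  (T.pathHeap A p).filter (fun v => ∀ q ∈ T.TallChain A P p, v ∉ q)

/-- `q` is the parent of the unsupported short path `p` in the shrub forest of
unsupported short paths: `q` is the first short path on the chain of strict shrub
ancestors of `p`. -/
def ForestParent (T : RBTree V) (A : T.LeafAssignment) (P : Finset (Finset V))
    (q p : Finset V) : Prop :=
  q ∈ P ∧ p ∈ P ∧ T.IsShort A q ∧ T.IsShort A p ∧ ¬ T.IsSupported A P p ∧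
    T.ShrubStrictAnc q p ∧
    ∀ r ∈ P, T.ShrubStrictAnc r p → T.ShrubStrictAnc q r → ¬ T.IsShort A r

/-- `U` is the connected component of the shrub forest of unsupported short paths
rooted at the supported short path `r`. -/
def IsComponent (T : RBTree V) (A : T.LeafAssignment) (P : Finset (Finset V))
    (U : Finset (Finset V)) (r : Finset V) : Prop :=
  U ⊆ P ∧ r ∈ U ∧ T.IsShort A r ∧ T.IsSupported A P r ∧
    (∀ p ∈ U, T.IsShort A p) ∧
    (∀ p ∈ U, p ≠ r → ¬ T.IsSupported A P p) ∧
    (∀ p ∈ U, p ≠ r → ∃ q ∈ U, T.ForestParent A P q p) ∧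
    (∀ q ∈ U, ∀ p ∈ P, T.ForestParent A P q p → p ∈ U)

/-- `q` lies in the subtree of the shrub forest rooted at `p`. -/
def ForestDesc (T : RBTree V) (A : T.LeafAssignment) (P : Finset (Finset V))
    (p q : Finset V) : Prop :=
  Relation.ReflTransGen (fun a b => T.ForestParent A P a b) p q

/-- `U_p`: the nodes of `U` in the subtree of the shrub forest rooted at `p`. -/
def usub (T : RBTree V) (A : T.LeafAssignment) (P : Finset (Finset V))
    (U : Finset (Finset V)) (p : Finset V) : Finset (Finset V) :=
  U.filter (fun q => T.ForestDesc A P p q)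

/-- The children of `p` in the shrub forest (within `U`). -/
def forestChildren (T : RBTree V) (A : T.LeafAssignment) (P : Finset (Finset V))
    (U : Finset (Finset V)) (p : Finset V) : Finset (Finset V) :=
  U.filter (fun q => T.ForestParent A P p q)

/-- The residue `R_p = |H̃_p| − Σ_{q child of p} |H̃_q|`. -/
def residue (T : RBTree V) (A : T.LeafAssignment) (P : Finset (Finset V))
    (U : Finset (Finset V)) (p : Finset V) : ℤ :=
  ((T.redHeap A P p).card : ℤ) -
    ∑ q ∈ T.forestChildren A P U p, ((T.redHeap A P q).card : ℤ)

/-- `R⁺_p = max(R_p, 0)`. -/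
def resPlus (T : RBTree V) (A : T.LeafAssignment) (P : Finset (Finset V))
    (U : Finset (Finset V)) (p : Finset V) : ℤ :=
  max (T.residue A P U p) 0

/-- The weight `W_p = Σ_{q ∈ U_p} R⁺_q`. -/
def weight (T : RBTree V) (A : T.LeafAssignment) (P : Finset (Finset V))
    (U : Finset (Finset V)) (p : Finset V) : ℤ :=
  ∑ q ∈ T.usub A P U p, T.resPlus A P U q

end RBTree

namespace RBTree

variable {V : Type} [Fintype V] [DecidableEq V]

theorem mem_children {T : RBTree V} {v c : V} : c ∈ T.children v ↔ T.parent c = some v := by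
  simp [children]

theorem parentIter_add (T : RBTree V) (m k : ℕ) (v : V) :
    T.parentIter (m + k) v = (T.parentIter m v).bind (T.parentIter k) := by
  induction k with
  | zero => cases T.parentIter m v <;> simp [parentIter]
  | succ k ih =>
    rw [← add_assoc]
    simp only [parentIter, ih]
    cases T.parentIter m v <;> simp

theorem parentIter_succ' (T : RBTree V) (n : ℕ) (v : V) :
    T.parentIter (n + 1) v = (T.parent v).bind (T.parentIter n) := by
  rw [add_comm, parentIter_add]
  simp [parentIter]

theorem depth_of_parentIter (T : RBTree V) {n : ℕ} {v u : V} (h : T.parentIter n v = some u) :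
    T.depth v = T.depth u + n := by
  induction n generalizing u with
  | zero => simp_all [parentIter]
  | succ n ih =>
    simp only [parentIter, Option.bind_eq_some_iff] at h
    obtain ⟨w, hw, hu⟩ := h
    rw [ih hw, T.depth_parent _ _ hu]
    ring

theorem parentIter_sub {T : RBTree V} {m n : ℕ} {v u w : V} (hmn : m ≤ n)
    (hw : T.parentIter m v = some w) (hu : T.parentIter n v = some u) :
    T.parentIter (n - m) w = some u := by
  have h := T.parentIter_add m (n - m) v
  rw [Nat.add_sub_cancel' hmn, hu, hw] at h
  simpa using h.symm

theorem Anc.refl (T : RBTree V) (v : V) : T.Anc v v := ⟨0, rfl⟩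

theorem Anc.trans {T : RBTree V} {u v w : V} (h₁ : T.Anc u v) (h₂ : T.Anc v w) : T.Anc u w := by
  obtain ⟨n, hn⟩ := h₁
  obtain ⟨m, hm⟩ := h₂
  exact ⟨m + n, by rw [parentIter_add, hm]; simpa using hn⟩

theorem anc_of_parent {T : RBTree V} {c v : V} (h : T.parent c = some v) : T.Anc v c :=
  ⟨1, by simpa [parentIter] using h⟩

theorem Anc.eq_of_depth_eq {T : RBTree V} {u w l : V} (hu : T.Anc u l) (hw : T.Anc w l)
    (h : T.depth u = T.depth w) : u = w := by
  obtain ⟨n, hn⟩ := hu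
  obtain ⟨m, hm⟩ := hw
  have h₁ := T.depth_of_parentIter hn
  have h₂ := T.depth_of_parentIter hm
  obtain rfl : n = m := by omega
  exact Option.some.inj (hn.symm.trans hm)

theorem mem_heap {T : RBTree V} {A : T.LeafAssignment} {u v : V} :
    u ∈ T.heap A v ↔ T.StrictAnc u v ∧ ∃ l ∈ A.χ u, T.Anc v l := by
  simp only [heap, Finset.mem_filter, Finset.mem_univ, true_and, Finset.Nonempty,
    Finset.mem_inter, subtreeLeaves]
  constructor
  · rintro ⟨h, l, hl, -, hv⟩
    exact ⟨h, l, hl, hv⟩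
  · rintro ⟨h, l, hl, hv⟩
    exact ⟨h, l, hl, A.mem_leaf _ _ hl, hv⟩

theorem heap_root (T : RBTree V) (A : T.LeafAssignment) : T.heap A T.root = ∅ := by
  refine Finset.eq_empty_of_forall_notMem fun u hu => ?_
  obtain ⟨⟨n, hn, h⟩, -⟩ := mem_heap.1 hu
  obtain ⟨n, rfl⟩ := Nat.exists_eq_succ_of_ne_zero hn.ne'
  simp [parentIter_succ', T.parent_root] at h

theorem strictAnc_of_child {T : RBTree V} {u v c : V} (hc : T.parent c = some v)
    (hu : T.StrictAnc u c) (hne : u ≠ v) : T.StrictAnc u v := by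
  obtain ⟨n, hn, h⟩ := hu
  obtain ⟨n, rfl⟩ := Nat.exists_eq_succ_of_ne_zero hn.ne'
  rw [Nat.succ_eq_add_one, parentIter_succ', hc] at h
  refine ⟨n, Nat.pos_of_ne_zero ?_, by simpa using h⟩
  rintro rfl
  simp [parentIter] at h
  exact hne h.symm

/-- Below a strict ancestor `u` of `v`, at most one leaf of `χ u` lies in the subtree of `v`. -/
theorem LeafAssignment.eq_of_anc {T : RBTree V} (A : T.LeafAssignment) {u v l l' : V}
    (hu : T.StrictAnc u v) (hl : l ∈ A.χ u) (hl' : l' ∈ A.χ u) (hv : T.Anc v l)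
    (hv' : T.Anc v l') : l = l' := by
  obtain ⟨n, hn, h⟩ := hu
  obtain ⟨n, rfl⟩ := Nat.exists_eq_succ_of_ne_zero hn.ne'
  simp only [parentIter, Option.bind_eq_some_iff] at h
  obtain ⟨d, hd, hdu⟩ := h
  exact (A.unique_child u d (mem_children.2 hdu)).unique
    ⟨hl, Anc.trans ⟨n, hd⟩ hv⟩ ⟨hl', Anc.trans ⟨n, hd⟩ hv'⟩

theorem sum_card_heap_children_le (T : RBTree V) (A : T.LeafAssignment) (v : V) :
    ∑ c ∈ T.children v, (T.heap A c).card ≤ (T.heap A v).card + 2 := by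
  have hdisj : (T.children v : Set V).PairwiseDisjoint (fun c => (T.heap A c).erase v) := by
    intro c hc c' hc' hne
    refine Finset.disjoint_left.2 fun u hu hu' => hne ?_
    rw [Finset.mem_coe, mem_children] at hc hc'
    obtain ⟨huv, hu⟩ := Finset.mem_erase.1 hu
    obtain ⟨hs, l, hl, hcl⟩ := mem_heap.1 hu
    obtain ⟨-, l', hl', hcl'⟩ := mem_heap.1 (Finset.mem_erase.1 hu').2
    obtain rfl := A.eq_of_anc (strictAnc_of_child hc hs huv) hl hl'
      ((anc_of_parent hc).trans hcl) ((anc_of_parent hc').trans hcl')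
    exact hcl.eq_of_depth_eq hcl' (by rw [T.depth_parent _ _ hc, T.depth_parent _ _ hc'])
  have hsub : (T.children v).biUnion (fun c => (T.heap A c).erase v) ⊆ T.heap A v := by
    intro u hu
    obtain ⟨c, hc, hu⟩ := Finset.mem_biUnion.1 hu
    rw [mem_children] at hc
    obtain ⟨huv, hu⟩ := Finset.mem_erase.1 hu
    obtain ⟨hs, l, hl, hcl⟩ := mem_heap.1 hu
    exact mem_heap.2 ⟨strictAnc_of_child hc hs huv, l, hl, (anc_of_parent hc).trans hcl⟩
  have hcard := Finset.card_le_card hsub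
  rw [Finset.card_biUnion hdisj] at hcard
  have hchild : (T.children v).card ≤ 2 := T.binary v
  calc ∑ c ∈ T.children v, (T.heap A c).card
      ≤ ∑ c ∈ T.children v, (((T.heap A c).erase v).card + 1) := by
        refine Finset.sum_le_sum fun c _ => ?_
        have := Finset.pred_card_le_card_erase (s := T.heap A c) (a := v)
        omega
    _ = ∑ c ∈ T.children v, ((T.heap A c).erase v).card + (T.children v).card := by
        simp [Finset.sum_add_distrib]
    _ ≤ _ := by omega

/-- The vertices hanging off `p`: the bases of the children of `p` in the shrub. -/
def hanging (T : RBTree V) (p : Finset V) : Finset V := p.biUnion T.children \ p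

theorem mem_hanging {T : RBTree V} {p : Finset V} {c : V} :
    c ∈ T.hanging p ↔ (∃ v ∈ p, T.parent c = some v) ∧ c ∉ p := by
  simp [hanging, mem_children]

/-- `b` is the top and `l` the bottom of the leaf path `p`. -/
structure IsLeafPathFrom (T : RBTree V) (p : Finset V) (l b : V) : Prop where
  leaf : T.IsLeaf l
  anc : T.Anc b l
  mem_iff : ∀ u, u ∈ p ↔ T.Anc u l ∧ T.Anc b u

theorem IsLeafPath.exists_from {T : RBTree V} {p : Finset V} (h : T.IsLeafPath p) :
    ∃ b l, T.IsLeafPathFrom p l b := by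
  obtain ⟨l, b, hl, hb, rfl⟩ := h
  exact ⟨b, l, hl, hb, by simp⟩

namespace IsLeafPathFrom

variable {T : RBTree V} {p : Finset V} {l b : V}

theorem top_mem (h : T.IsLeafPathFrom p l b) : b ∈ p := (h.mem_iff b).2 ⟨h.anc, Anc.refl T b⟩

theorem exists_parent_mem (h : T.IsLeafPathFrom p l b) {c : V} (hc : c ∈ p) (hne : c ≠ b) :
    ∃ v ∈ p, T.parent c = some v := by
  obtain ⟨hcl, n, hn⟩ := (h.mem_iff c).1 hc
  cases n with
  | zero => exact absurd (Option.some.inj hn) hne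
  | succ n =>
    rw [parentIter_succ', Option.bind_eq_some_iff] at hn
    obtain ⟨v, hv, hn⟩ := hn
    exact ⟨v, (h.mem_iff v).2 ⟨(anc_of_parent hv).trans hcl, n, hn⟩, hv⟩

theorem parent_top_notMem (h : T.IsLeafPathFrom p l b) {u : V} (hu : T.parent b = some u) :
    u ∉ p := by
  intro hup
  obtain ⟨-, n, hn⟩ := (h.mem_iff u).1 hup
  have h₁ := T.depth_of_parentIter hn
  have h₂ := T.depth_parent _ _ hu
  omega

theorem exists_child_mem (h : T.IsLeafPathFrom p l b) {v : V} (hv : v ∈ p)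
    (hne : ¬ T.IsLeaf v) : ∃ c ∈ p, T.parent c = some v := by
  obtain ⟨⟨n, hn⟩, hbv⟩ := (h.mem_iff v).1 hv
  cases n with
  | zero =>
    obtain rfl : l = v := Option.some.inj hn
    exact absurd h.leaf hne
  | succ n =>
    simp only [parentIter, Option.bind_eq_some_iff] at hn
    obtain ⟨c, hc, hcv⟩ := hn
    exact ⟨c, (h.mem_iff c).2 ⟨⟨n, hc⟩, hbv.trans (anc_of_parent hcv)⟩, hcv⟩

theorem heap_subset (h : T.IsLeafPathFrom p l b) (A : T.LeafAssignment) {v : V} (hv : v ∈ p) :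
    T.heap A v ⊆ T.heap A b ∪ p := by
  intro u hu
  obtain ⟨⟨n, hn, hun⟩, l', hl', hvl⟩ := mem_heap.1 hu
  obtain ⟨hvl₀, m, hm⟩ := (h.mem_iff v).1 hv
  rw [Finset.mem_union]
  rcases le_or_gt n m with hnm | hnm
  · exact Or.inr ((h.mem_iff u).2 ⟨Anc.trans ⟨n, hun⟩ hvl₀, m - n, parentIter_sub hnm hun hm⟩)
  · exact Or.inl (mem_heap.2 ⟨⟨n - m, by omega, parentIter_sub hnm.le hm hun⟩, l', hl',
      Anc.trans ⟨m, hm⟩ hvl⟩)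

theorem card_heap_le (h : T.IsLeafPathFrom p l b) (A : T.LeafAssignment) {v : V} (hv : v ∈ p) :
    (T.heap A v).card ≤ (T.heap A b).card + p.card :=
  (Finset.card_le_card (h.heap_subset A hv)).trans (Finset.card_union_le _ _)

theorem sum_card_heap_hanging_le (h : T.IsLeafPathFrom p l b) (A : T.LeafAssignment) :
    ∑ c ∈ T.hanging p, (T.heap A c).card ≤ (T.heap A b).card + 2 * p.card := by
  have hdisj : (p : Set V).PairwiseDisjoint T.children := by
    intro v _ v' _ hne
    refine Finset.disjoint_left.2 fun c hc hc' => hne ?_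
    exact Option.some.inj ((mem_children.1 hc).symm.trans (mem_children.1 hc'))
  have hdisj' : Disjoint (T.hanging p) (p.erase b) :=
    Finset.disjoint_left.2 fun c hc hc' => (mem_hanging.1 hc).2 (Finset.mem_of_mem_erase hc')
  have hsub : T.hanging p ∪ p.erase b ⊆ p.biUnion T.children := by
    refine Finset.union_subset Finset.sdiff_subset fun c hc => ?_
    obtain ⟨v, hv, hcv⟩ := h.exists_parent_mem (Finset.mem_of_mem_erase hc)
      (Finset.ne_of_mem_erase hc)
    exact Finset.mem_biUnion.2 ⟨v, hv, mem_children.2 hcv⟩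
  have h₁ := Finset.sum_le_sum_of_subset (f := fun c => (T.heap A c).card) hsub
  rw [Finset.sum_union hdisj', Finset.sum_biUnion hdisj] at h₁
  have h₂ := Finset.sum_le_sum fun v (_ : v ∈ p) => T.sum_card_heap_children_le A v
  rw [Finset.sum_add_distrib,
    ← Finset.add_sum_erase p (fun v => (T.heap A v).card) h.top_mem] at h₂
  simp only [Finset.sum_const, smul_eq_mul] at h₂
  omega

theorem two_mul_card_heap_hanging_le (h : T.IsLeafPathFrom p l b) (A : T.LeafAssignment)
    (hmax : ∀ v ∈ p, ∀ c ∈ T.children v, c ∈ p →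
      ∀ c' ∈ T.children v, (T.heap A c').card ≤ (T.heap A c).card)
    {c : V} (hc : c ∈ T.hanging p) :
    2 * (T.heap A c).card ≤ (T.heap A b).card + p.card + 2 := by
  obtain ⟨⟨v, hv, hcv⟩, hcp⟩ := mem_hanging.1 hc
  have hcv' := mem_children.2 hcv
  obtain ⟨d, hd, hdv⟩ := h.exists_child_mem hv (Finset.ne_empty_of_mem hcv')
  have hdv' := mem_children.2 hdv
  have hne : c ≠ d := fun e => hcp (e ▸ hd)
  have h₁ := hmax v hv d hdv' hd c hcv'
  have h₂ : ∑ x ∈ {c, d}, (T.heap A x).card ≤ ∑ x ∈ T.children v, (T.heap A x).card :=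
    Finset.sum_le_sum_of_subset (Finset.insert_subset hcv' (Finset.singleton_subset_iff.2 hdv'))
  rw [Finset.sum_pair hne] at h₂
  have h₃ := T.sum_card_heap_children_le A v
  have h₄ := h.card_heap_le A hv
  omega

end IsLeafPathFrom

namespace IsPathDecomp

variable {T : RBTree V} {P : Finset (Finset V)}

theorem eq_of_mem (h : T.IsPathDecomp P) {p q : Finset V} {v : V} (hp : p ∈ P) (hq : q ∈ P)
    (hvp : v ∈ p) (hvq : v ∈ q) : p = q :=
  (h.2 v).unique ⟨hp, hvp⟩ ⟨hq, hvq⟩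

theorem sum_sum (h : T.IsPathDecomp P) (f : V → ℝ) : ∑ p ∈ P, ∑ v ∈ p, f v = ∑ v, f v := by
  have hdisj : (P : Set (Finset V)).PairwiseDisjoint id := fun p hp q hq hne =>
    Finset.disjoint_left.2 fun v hvp hvq => hne (h.eq_of_mem hp hq hvp hvq)
  have huniv : P.biUnion id = Finset.univ := by
    ext v
    obtain ⟨p, hp, -⟩ := h.2 v
    simpa using ⟨p, hp⟩
  rw [← huniv, Finset.sum_biUnion hdisj]
  rfl

/-- Every path top other than the root hangs off exactly one path, so sums over path tops are
bounded by sums over hanging vertices. -/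
theorem sum_top_le_sum_hanging (h : T.IsPathDecomp P) {top : Finset V → V}
    (htop : ∀ p ∈ P, ∃ l, T.IsLeafPathFrom p l (top p)) {f : V → ℝ} (hf : ∀ v, 0 ≤ f v)
    (hroot : f T.root = 0) :
    ∑ p ∈ P, f (top p) ≤ ∑ p ∈ P, ∑ c ∈ T.hanging p, f c := by
  have hinj : Set.InjOn top P := by
    intro p hp q hq e
    obtain ⟨l, hl⟩ := htop p hp
    obtain ⟨l', hl'⟩ := htop q hq
    exact h.eq_of_mem hp hq hl.top_mem (e ▸ hl'.top_mem)
  have hdisj : (P : Set (Finset V)).PairwiseDisjoint T.hanging := by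
    intro p hp q hq hne
    refine Finset.disjoint_left.2 fun c hc hc' => hne ?_
    obtain ⟨⟨v, hv, hcv⟩, -⟩ := mem_hanging.1 hc
    obtain ⟨⟨v', hv', hcv'⟩, -⟩ := mem_hanging.1 hc'
    obtain rfl := Option.some.inj (hcv.symm.trans hcv')
    exact h.eq_of_mem hp hq hv hv'
  rw [← Finset.sum_image hinj, ← Finset.sum_biUnion hdisj,
    ← Finset.sum_erase (P.image top) hroot]
  refine Finset.sum_le_sum_of_subset_of_nonneg (fun c hc => ?_) fun v _ _ => hf v
  obtain ⟨hne, hc⟩ := Finset.mem_erase.1 hc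
  obtain ⟨p, hp, rfl⟩ := Finset.mem_image.1 hc
  obtain ⟨l, hl⟩ := htop p hp
  obtain ⟨u, hu⟩ := Option.ne_none_iff_exists'.1 fun e => hne (T.root_of_parent_none _ e)
  obtain ⟨q, ⟨hq, huq⟩, -⟩ := h.2 u
  refine Finset.mem_biUnion.2 ⟨q, hq, mem_hanging.2 ⟨⟨u, huq, hu⟩, fun hpq => ?_⟩⟩
  rw [← h.eq_of_mem hp hq hl.top_mem hpq] at huq
  exact hl.parent_top_notMem hu huq

end IsPathDecomp

end RBTree

/-- The potential absorbed by a path whose base has a heap of size `n`. -/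
def heapPotential (n : ℕ) : ℝ := 40 * (n - √n)

theorem heapPotential_zero : heapPotential 0 = 0 := by simp [heapPotential]

theorem heapPotential_nonneg (n : ℕ) : 0 ≤ heapPotential n := by
  rcases Nat.eq_zero_or_pos n with rfl | hn
  · simp [heapPotential]
  · have h : (1 : ℝ) ≤ n := by exact_mod_cast hn
    have := Real.sqrt_le_self_iff.2 (Or.inr h)
    unfold heapPotential
    linarith

theorem sum_heapPotential_le {ι : Type*} (S : Finset ι) (x : ι → ℕ) {h m : ℕ}
    (hsum : ∑ i ∈ S, x i ≤ h + m) :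
    ∑ i ∈ S, heapPotential (x i) ≤ heapPotential h + 40 * m := by
  set s : ℕ := ∑ i ∈ S, x i with hs
  have hsR : (s : ℝ) = ∑ i ∈ S, (x i : ℝ) := by rw [hs]; push_cast; rfl
  have hsqrt : √(s : ℝ) ≤ ∑ i ∈ S, √(x i : ℝ) := by
    rcases Nat.eq_zero_or_pos s with h0 | h0
    · rw [h0]
      simpa using Finset.sum_nonneg fun i (_ : i ∈ S) => Real.sqrt_nonneg (x i : ℝ)
    · have hpos : 0 < √(s : ℝ) := Real.sqrt_pos.2 (by exact_mod_cast h0)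
      refine le_of_mul_le_mul_right ?_ hpos
      rw [Real.mul_self_sqrt (Nat.cast_nonneg _), Finset.sum_mul]
      nth_rewrite 1 [hsR]
      refine Finset.sum_le_sum fun i hi => ?_
      nth_rewrite 1 [← Real.mul_self_sqrt (Nat.cast_nonneg (x i))]
      gcongr
      exact Finset.single_le_sum (f := x) (fun _ _ => Nat.zero_le _) hi
  have hmono : (s : ℝ) - √s ≤ h - √h + m := by
    have h1 : (s : ℝ) ≤ h + m := by exact_mod_cast hsum
    rcases le_or_gt h s with hle | hlt
    · have := Real.sqrt_le_sqrt (show (h : ℝ) ≤ s by exact_mod_cast hle)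
      linarith
    · have h2 : (1 : ℝ) ≤ √h := Real.one_le_sqrt.2 (by exact_mod_cast Nat.one_le_of_lt hlt)
      have h3 := Real.sqrt_le_sqrt (show (s : ℝ) ≤ h by exact_mod_cast hlt.le)
      have h4 := Real.mul_self_sqrt (Nat.cast_nonneg (α := ℝ) h)
      have h5 := Real.mul_self_sqrt (Nat.cast_nonneg (α := ℝ) s)
      have h6 := Real.sqrt_nonneg (s : ℝ)
      have h7 : (0 : ℝ) ≤ m := Nat.cast_nonneg m
      nlinarith [mul_nonneg (sub_nonneg.2 h3) (sub_nonneg.2 h2), mul_nonneg (sub_nonneg.2 h3) h6]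
  simp only [heapPotential, ← Finset.mul_sum, Finset.sum_sub_distrib]
  rw [← hsR]
  linarith

/-- Balanced splittings decrease the potential by a multiple of `√h`. -/
theorem sum_heapPotential_le_of_balanced {ι : Type*} (S : Finset ι) (x : ι → ℕ) {h m : ℕ}
    (hh : 2 ≤ h) (hsum : ∑ i ∈ S, x i ≤ h + m) (hx : ∀ i ∈ S, 16 * x i ≤ 9 * h) :
    ∑ i ∈ S, heapPotential (x i) ≤ heapPotential h + 40 * m - 40 / 3 * √h := by
  set r := √(h : ℝ) with hr
  have hrr : r * r = h := Real.mul_self_sqrt (Nat.cast_nonneg h)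
  have hhR : (2 : ℝ) ≤ h := by exact_mod_cast hh
  have hr1 : 4 / 3 ≤ r := Real.le_sqrt_of_sq_le (by linarith)
  have hsumR : ∑ i ∈ S, (x i : ℝ) ≤ h + m := by exact_mod_cast hsum
  have hsqrt : ∑ i ∈ S, (x i : ℝ) ≤ 3 / 4 * r * ∑ i ∈ S, √(x i : ℝ) := by
    rw [Finset.mul_sum]
    refine Finset.sum_le_sum fun i hi => ?_
    have h1 : √(x i : ℝ) ≤ 3 / 4 * r := by
      refine Real.sqrt_le_iff.2 ⟨by positivity, ?_⟩
      have : (16 : ℝ) * x i ≤ 9 * h := by exact_mod_cast hx i hi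
      nlinarith
    nth_rewrite 1 [← Real.mul_self_sqrt (Nat.cast_nonneg (x i))]
    gcongr
  simp only [heapPotential, ← Finset.mul_sum, Finset.sum_sub_distrib, ← hr]
  generalize ∑ i ∈ S, (x i : ℝ) = s at *
  generalize ∑ i ∈ S, √(x i : ℝ) = t at *
  have hm : (0 : ℝ) ≤ m := Nat.cast_nonneg m
  have hrpos : 0 < r := by linarith
  have key : s - t ≤ h + m - 4 / 3 * r := by
    refine le_of_mul_le_mul_right ?_ hrpos
    nlinarith [mul_nonneg (sub_nonneg.2 hsumR) (sub_nonneg.2 hr1)]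
  linarith

theorem mul_log_le_eight_mul_log {h n : ℕ} (hn : 1 ≤ n) (hh : h ≤ 100 * n ^ 4) :
    (n : ℝ) * Real.log (1 + (h + n)) ≤ 8 * (n * Real.log (1 + n)) := by
  have hnR : (1 : ℝ) ≤ n := by exact_mod_cast hn
  have hhR : (h : ℝ) ≤ 100 * n ^ 4 := by exact_mod_cast hh
  have h1 : (1 : ℝ) + (h + n) ≤ (1 + n) ^ 8 := by
    have h2 : (4 : ℝ) * n ≤ (1 + n) ^ 2 := by nlinarith [sq_nonneg ((n : ℝ) - 1)]
    have h3 : ((4 : ℝ) * n) ^ 4 ≤ ((1 + n) ^ 2) ^ 4 := by gcongr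
    have h4 : (n : ℝ) ≤ n ^ 4 := le_self_pow₀ hnR (by norm_num)
    nlinarith
  have h2 : Real.log (1 + (h + n)) ≤ 8 * Real.log (1 + n) := by
    have := Real.log_le_log (by positivity) h1
    rwa [Real.log_pow, Nat.cast_ofNat] at this
  nlinarith

theorem mul_log_le_eight_mul_sqrt {h n : ℕ} (hn : 1 ≤ n) (hh : 100 * n ^ 4 ≤ h) :
    (n : ℝ) * Real.log (1 + (h + n)) ≤ 8 * √h := by
  have hnR : (1 : ℝ) ≤ n := by exact_mod_cast hn
  have hhR : 100 * (n : ℝ) ^ 4 ≤ h := by exact_mod_cast hh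
  set t := √√(h : ℝ) with ht
  have ht2 : t ^ 2 = √h := Real.sq_sqrt (Real.sqrt_nonneg _)
  have ht4 : t ^ 4 = h := by
    rw [show t ^ 4 = (t ^ 2) ^ 2 by ring, ht2, Real.sq_sqrt (Nat.cast_nonneg _)]
  have ht0 : 0 ≤ t := Real.sqrt_nonneg _
  have hn4 : (n : ℝ) ≤ n ^ 4 := le_self_pow₀ hnR (by norm_num)
  have hnt : (n : ℝ) ≤ t := by
    refine le_of_pow_le_pow_left₀ (n := 4) (by norm_num) ht0 ?_
    rw [ht4]
    linarith
  have h1 : (1 : ℝ) + (h + n) ≤ (2 * t) ^ 4 := by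
    rw [mul_pow, ht4]
    linarith
  have h2 : Real.log (1 + (h + n)) ≤ 8 * t := by
    have h3 := Real.log_le_log (by positivity) h1
    rw [Real.log_pow, Nat.cast_ofNat] at h3
    have h4 := Real.log_le_self (show 0 ≤ 2 * t by linarith)
    linarith
  calc (n : ℝ) * Real.log (1 + (h + n)) ≤ n * (8 * t) := by gcongr
    _ ≤ t * (8 * t) := by gcongr
    _ = 8 * √h := by rw [← ht2]; ring

theorem mul_log_add_sum_heapPotential_le {ι : Type*} (S : Finset ι) (x : ι → ℕ) {h n : ℕ}
    (hn : 1 ≤ n) (hsum : ∑ i ∈ S, x i ≤ h + 2 * n) (hx : ∀ i ∈ S, 2 * x i ≤ h + n + 2) :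
    n * Real.log (1 + (h + n)) + ∑ i ∈ S, heapPotential (x i) ≤
      168 * (n * Real.log (1 + n)) + heapPotential h := by
  have hnR : (1 : ℝ) ≤ n := by exact_mod_cast hn
  have hlog : 1 / 2 ≤ Real.log (1 + n) :=
    calc (1 / 2 : ℝ) ≤ Real.log 2 := by linarith [Real.log_two_gt_d9]
      _ ≤ _ := Real.log_le_log (by norm_num) (by linarith)
  have hn2 : (n : ℝ) ≤ 2 * (n * Real.log (1 + n)) := by nlinarith
  rcases le_total h (100 * n ^ 4) with hh | hh
  · have h1 := mul_log_le_eight_mul_log hn hh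
    have h2 := sum_heapPotential_le S x hsum
    push_cast at h2
    linarith
  · have hn4 : n ≤ n ^ 4 := Nat.le_self_pow (by norm_num) n
    have h1 := mul_log_le_eight_mul_sqrt hn hh
    have h2 := sum_heapPotential_le_of_balanced S x (by omega) hsum fun i hi => by
      have := hx i hi
      omega
    push_cast at h2
    have h3 := Real.sqrt_nonneg (h : ℝ)
    linarith

theorem RBTree.IsLeafPathFrom.sum_log_add_sum_heapPotential_le {V : Type} [Fintype V]
    [DecidableEq V] {T : RBTree V} {p : Finset V} {l b : V} (h : T.IsLeafPathFrom p l b)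
    (A : T.LeafAssignment)
    (hmax : ∀ v ∈ p, ∀ c ∈ T.children v, c ∈ p →
      ∀ c' ∈ T.children v, (T.heap A c').card ≤ (T.heap A c).card) :
    ∑ v ∈ p, Real.log (1 + ((T.heap A v).card : ℝ)) +
        ∑ c ∈ T.hanging p, heapPotential (T.heap A c).card ≤
      168 * (p.card * Real.log (1 + (p.card : ℝ))) + heapPotential (T.heap A b).card := by
  have hcost : ∑ v ∈ p, Real.log (1 + ((T.heap A v).card : ℝ)) ≤
      p.card * Real.log (1 + ((T.heap A b).card + p.card)) := by
    rw [← nsmul_eq_mul]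
    refine Finset.sum_le_card_nsmul _ _ _ fun v hv => Real.log_le_log (by positivity) ?_
    have : ((T.heap A v).card : ℝ) ≤ (T.heap A b).card + p.card := by
      exact_mod_cast h.card_heap_le A hv
    linarith
  have := mul_log_add_sum_heapPotential_le (T.hanging p) (fun c => (T.heap A c).card)
    (Finset.card_pos.2 ⟨b, h.top_mem⟩) (h.sum_card_heap_hanging_le A)
    fun c hc => h.two_mul_card_heap_hanging_le A hmax hc
  linarith

open RBTree in
/-- there is an absolute constant `C > 0` such that for every finite rooted
binary tree `T`, leaf assignment `χ`, and maximum path decomposition `P_max(T)`,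
`Σ_v log(1 + |H_v|) ≤ C · Σ_{p ∈ P_max(T)} |p| · log(1 + |p|)`. -/
theorem max_path_decomp_bounds_heap_logs :
    ∃ C : ℝ, 0 < C ∧
      ∀ (V : Type) [Fintype V] [DecidableEq V] (T : RBTree V) (A : T.LeafAssignment)
        (P : Finset (Finset V)), T.IsMaxPathDecomp A P →
        ∑ v : V, Real.log (1 + ((T.heap A v).card : ℝ)) ≤
          C * ∑ p ∈ P, (p.card : ℝ) * Real.log (1 + (p.card : ℝ)) := by
  refine ⟨168, by norm_num, fun V _ _ T A P hP => ?_⟩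
  obtain ⟨hdec, hmax⟩ := hP
  have : Nonempty V := ⟨T.root⟩
  choose! top htop using fun p hp => (hdec.1 p hp).exists_from
  have h₁ := hdec.sum_top_le_sum_hanging htop (f := fun v => heapPotential (T.heap A v).card)
    (fun v => heapPotential_nonneg _) (by simp [heap_root, heapPotential_zero])
  have h₂ := Finset.sum_le_sum fun p (hp : p ∈ P) =>
    (htop p hp).choose_spec.sum_log_add_sum_heapPotential_le A (hmax p hp)
  simp only [Finset.sum_add_distrib, hdec.sum_sum, ← Finset.mul_sum] at h₂
  linarith
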